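/- arXiv:1403.0150 — 2 statements merged into one kernel-verified Lean document; each statement's English description precedes it below -/
import Mathlib

section
/- Let F = (F_1, …, F_m) : ℝⁿ → ℝᵐ have each component F_i continuously differentiable on ℝⁿ, quasiconvex and positive, satisfying the completeness assumption (H3) relative to the initial point x⁰, and let {x^k} be an SPPM sequence with 0 < α_k < ᾱ, ‖e_k‖ = 1, ‖z_k‖ = 1, such that for every k the interior of Ω_{k+1} is nonempty with F(x) ≺ F(x^{k+1}) for every x in that interior. Then {x^k} converges to a Pareto critical point x̄ of min{F(x) : x ∈ ℝⁿ}: for every d ∈ ℝⁿ there exists i₀ ∈ {1, …, m} such that ⟨∇F_{i₀}(x̄), d⟩ ≥ 0. -/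
open Filter Metric Set
open scoped Topology RealInnerProductSpace Pointwise

/-- The Clarke directional derivative of `f` at `x` in the direction `d`. -/
noncomputable def clarkeDeriv {n : ℕ} (f : EuclideanSpace ℝ (Fin n) → ℝ)
    (x d : EuclideanSpace ℝ (Fin n)) : ℝ :=
  Filter.limsup (fun p : EuclideanSpace ℝ (Fin n) × ℝ => (f (p.1 + p.2 • d) - f p.1) / p.2)
    ((𝓝 x) ×ˢ (𝓝[>] (0 : ℝ)))

/-- The Clarke subdifferential of `f` at `x`. -/
def clarkeSubdiff {n : ℕ} (f : EuclideanSpace ℝ (Fin n) → ℝ) (x : EuclideanSpace ℝ (Fin n)) :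
    Set (EuclideanSpace ℝ (Fin n)) :=
  {w | ∀ d, ⟪w, d⟫ ≤ clarkeDeriv f x d}

/-- The normal cone to `D` at `x`. -/
def normalCone {n : ℕ} (D : Set (EuclideanSpace ℝ (Fin n))) (x : EuclideanSpace ℝ (Fin n)) :
    Set (EuclideanSpace ℝ (Fin n)) :=
  {v | ∀ y ∈ D, ⟪v, y - x⟫ ≤ 0}

/-- `f` is locally Lipschitz on `ℝⁿ`. -/
def LocLipOn {n : ℕ} (f : EuclideanSpace ℝ (Fin n) → ℝ) : Prop :=
  ∀ x, ∃ ε > (0 : ℝ), ∃ L > (0 : ℝ),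
    ∀ z ∈ ball x ε, ∀ y ∈ ball x ε, |f z - f y| ≤ L * ‖z - y‖

/-- `f` is quasiconvex. -/
def QuasiconvexFun {n : ℕ} (f : EuclideanSpace ℝ (Fin n) → ℝ) : Prop :=
  ∀ x y, ∀ t ∈ Set.Icc (0 : ℝ) 1, f (t • x + (1 - t) • y) ≤ max (f x) (f y)

/-- An SPPM sequence for `F` with parameters `α`, `e`, `z`: for every `k`,
`x^{k+1} ∈ Ω_k = {x : F(x) ⪯ F(x^k)}` and `0 ∈ ∂°h_k(x^{k+1}) + N_{Ω_k}(x^{k+1})`,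
where `h_k(x) = ⟨F(x), z_k⟩ + (α_k/2)⟨e_k, z_k⟩‖x − x^k‖²`. -/
def SPPMSeq {n m : ℕ} (F : Fin m → EuclideanSpace ℝ (Fin n) → ℝ)
    (x : ℕ → EuclideanSpace ℝ (Fin n)) (α : ℕ → ℝ)
    (e z : ℕ → EuclideanSpace ℝ (Fin m)) : Prop :=
  (∀ k, 0 < α k) ∧ (∀ k i, 0 < e k i) ∧ (∀ k i, 0 ≤ z k i) ∧ (∀ k, z k ≠ 0) ∧
  (∀ k, (∀ i, F i (x (k + 1)) ≤ F i (x k)) ∧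
    (0 : EuclideanSpace ℝ (Fin n)) ∈
      clarkeSubdiff
        (fun y => (∑ i, z k i * F i y) + α k / 2 * (∑ i, e k i * z k i) * ‖y - x k‖ ^ 2)
        (x (k + 1)) +
      normalCone {y : EuclideanSpace ℝ (Fin n) | ∀ i, F i y ≤ F i (x k)} (x (k + 1)))


/-- The completeness assumption (H3) relative to the initial point `x0`. -/
def H3 {n m : ℕ} (F : Fin m → EuclideanSpace ℝ (Fin n) → ℝ)
    (x0 : EuclideanSpace ℝ (Fin n)) : Prop :=
  ∀ a : ℕ → EuclideanSpace ℝ (Fin n), a 0 = x0 →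
    (∀ k, ∀ i, F i (a (k + 1)) ≤ F i (a k)) →
    ∃ b : EuclideanSpace ℝ (Fin n), ∀ k, ∀ i, F i b ≤ F i (a k)

/-- The difference quotients appearing in the Clarke directional derivative converge at points of
strict differentiability. -/
theorem HasStrictFDerivAt.tendsto_clarke_quotient {n : ℕ} {f : EuclideanSpace ℝ (Fin n) → ℝ}
    {f' : EuclideanSpace ℝ (Fin n) →L[ℝ] ℝ} {x : EuclideanSpace ℝ (Fin n)}
    (hf : HasStrictFDerivAt f f' x) (d : EuclideanSpace ℝ (Fin n)) :
    Tendsto (fun p : EuclideanSpace ℝ (Fin n) × ℝ => (f (p.1 + p.2 • d) - f p.1) / p.2)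
      ((𝓝 x) ×ˢ (𝓝[>] (0 : ℝ))) (𝓝 (f' d)) := by
  have hfst : Tendsto (fun p : EuclideanSpace ℝ (Fin n) × ℝ => p.1)
      ((𝓝 x) ×ˢ (𝓝[>] (0 : ℝ))) (𝓝 x) := tendsto_fst
  have hsnd : Tendsto (fun p : EuclideanSpace ℝ (Fin n) × ℝ => p.2)
      ((𝓝 x) ×ˢ (𝓝[>] (0 : ℝ))) (𝓝[>] 0) := tendsto_snd
  have hmove : Tendsto (fun p : EuclideanSpace ℝ (Fin n) × ℝ => p.1 + p.2 • d)
      ((𝓝 x) ×ˢ (𝓝[>] (0 : ℝ))) (𝓝 x) := by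
    simpa using hfst.add ((hsnd.mono_right nhdsWithin_le_nhds).smul_const d)
  have ho := hf.isLittleO.comp_tendsto (hmove.prodMk_nhds hfst)
  have hO : ((fun p : EuclideanSpace ℝ (Fin n) × EuclideanSpace ℝ (Fin n) => p.1 - p.2) ∘
      fun p : EuclideanSpace ℝ (Fin n) × ℝ => (p.1 + p.2 • d, p.1))
      =O[(𝓝 x) ×ˢ (𝓝[>] (0 : ℝ))] fun p => p.2 := by
    refine Asymptotics.IsBigO.of_bound ‖d‖ (Eventually.of_forall fun p => ?_)
    simp [norm_smul, mul_comm]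
  have hlim := (ho.trans_isBigO hO).tendsto_div_nhds_zero.add_const (f' d)
  rw [zero_add] at hlim
  refine hlim.congr' ?_
  filter_upwards [hsnd.eventually self_mem_nhdsWithin] with p hp
  have hp : p.2 ≠ 0 := ne_of_gt hp
  simp only [Function.comp_apply, add_sub_cancel_left, map_smul, smul_eq_mul]
  field_simp
  ring

theorem HasStrictFDerivAt.clarkeDeriv_eq {n : ℕ} {f : EuclideanSpace ℝ (Fin n) → ℝ}
    {f' : EuclideanSpace ℝ (Fin n) →L[ℝ] ℝ} {x : EuclideanSpace ℝ (Fin n)}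
    (hf : HasStrictFDerivAt f f' x) (d : EuclideanSpace ℝ (Fin n)) :
    clarkeDeriv f x d = f' d :=
  (hf.tendsto_clarke_quotient d).limsup_eq

theorem HasStrictFDerivAt.tendsto_quotient {n : ℕ} {f : EuclideanSpace ℝ (Fin n) → ℝ}
    {f' : EuclideanSpace ℝ (Fin n) →L[ℝ] ℝ} {x : EuclideanSpace ℝ (Fin n)}
    (hf : HasStrictFDerivAt f f' x) (d : EuclideanSpace ℝ (Fin n)) :
    Tendsto (fun t : ℝ => (f (x + t • d) - f x) / t) (𝓝[>] 0) (𝓝 (f' d)) :=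
  (hf.tendsto_clarke_quotient d).comp (g := fun p : EuclideanSpace ℝ (Fin n) × ℝ =>
    (f (p.1 + p.2 • d) - f p.1) / p.2) (f := fun t => (x, t))
    (Tendsto.prodMk tendsto_const_nhds tendsto_id)

theorem QuasiconvexFun.strictFDeriv_nonpos {n : ℕ} {f : EuclideanSpace ℝ (Fin n) → ℝ}
    (hq : QuasiconvexFun f) {f' : EuclideanSpace ℝ (Fin n) →L[ℝ] ℝ}
    {x y : EuclideanSpace ℝ (Fin n)} (hf : HasStrictFDerivAt f f' x) (hyx : f y ≤ f x) :
    f' (y - x) ≤ 0 := by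
  refine le_of_tendsto (hf.tendsto_quotient (y - x)) ?_
  filter_upwards [Ioo_mem_nhdsGT (zero_lt_one' ℝ)] with t ht
  have h := hq y x t ⟨ht.1.le, ht.2.le⟩
  rw [max_eq_right hyx, show t • y + (1 - t) • x = x + t • (y - x) by module] at h
  exact div_nonpos_of_nonpos_of_nonneg (sub_nonpos.2 h) ht.1.le

/-- A sequence whose distances to `a` are nonincreasing converges to `a` as soon as one of its
subsequences does. -/
theorem tendsto_of_antitone_dist_of_subseq {X : Type*} [PseudoMetricSpace X] {x : ℕ → X} {a : X}
    (hanti : Antitone fun k => dist (x k) a) {φ : ℕ → ℕ} (hφ : Tendsto φ atTop atTop)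
    (hlim : Tendsto (x ∘ φ) atTop (𝓝 a)) : Tendsto x atTop (𝓝 a) := by
  rw [tendsto_iff_dist_tendsto_zero] at hlim ⊢
  exact (tendsto_iff_tendsto_subseq_of_antitone hanti hφ).2 hlim

/-- The variational inequality behind one step of the method, for smooth objectives. -/
theorem SPPMSeq.variational_inequality {n m : ℕ} {F : Fin m → EuclideanSpace ℝ (Fin n) → ℝ}
    {x : ℕ → EuclideanSpace ℝ (Fin n)} {α : ℕ → ℝ} {e z : ℕ → EuclideanSpace ℝ (Fin m)}
    (h : SPPMSeq F x α e z) (hsmooth : ∀ i, ContDiff ℝ 1 (F i)) (k : ℕ)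
    {y : EuclideanSpace ℝ (Fin n)} (hy : ∀ i, F i y ≤ F i (x k)) :
    0 ≤ (∑ i, z k i * fderiv ℝ (F i) (x (k + 1)) (y - x (k + 1))) +
      α k * (∑ i, e k i * z k i) * ⟪x (k + 1) - x k, y - x (k + 1)⟫ := by
  obtain ⟨w, hw, v, hv, hwv⟩ := Set.mem_add.1 (h.2.2.2.2 k).2
  have hF : ∀ i, HasStrictFDerivAt (F i) (fderiv ℝ (F i) (x (k + 1))) (x (k + 1)) := fun i =>
    (hsmooth i).contDiffAt.hasStrictFDerivAt one_ne_zero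
  have hsum : HasStrictFDerivAt (fun y => ∑ i, z k i * F i y)
      (∑ i, z k i • fderiv ℝ (F i) (x (k + 1))) (x (k + 1)) :=
    HasStrictFDerivAt.fun_sum fun i _ => (hF i).const_mul (z k i)
  have hsq : HasStrictFDerivAt (fun y => α k / 2 * (∑ i, e k i * z k i) * ‖y - x k‖ ^ 2)
      ((α k / 2 * (∑ i, e k i * z k i)) • (2 • innerSL ℝ (x (k + 1) - x k))) (x (k + 1)) :=
    ((hasStrictFDerivAt_norm_sq (x (k + 1) - x k)).comp (x (k + 1))
      ((hasStrictFDerivAt_id (x (k + 1))).sub_const (x k))).const_mul _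
  have hle := hw (y - x (k + 1))
  rw [(hsum.fun_add hsq).clarkeDeriv_eq] at hle
  have hneg := hv y hy
  rw [eq_neg_of_add_eq_zero_left hwv, inner_neg_left] at hle
  simp only [add_apply, sum_apply, smul_apply, smul_eq_mul, innerSL_apply_apply,
    nsmul_eq_mul, Nat.cast_ofNat] at hle
  linarith

theorem SPPMSeq.sum_mul_pos {n m : ℕ} {F : Fin m → EuclideanSpace ℝ (Fin n) → ℝ}
    {x : ℕ → EuclideanSpace ℝ (Fin n)} {α : ℕ → ℝ} {e z : ℕ → EuclideanSpace ℝ (Fin m)}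
    (h : SPPMSeq F x α e z) (k : ℕ) : 0 < ∑ i, e k i * z k i := by
  obtain ⟨-, he, hz, hz0, -⟩ := h
  obtain ⟨i, hi⟩ : ∃ i, z k i ≠ 0 := by
    by_contra! hall
    exact hz0 k (by ext i; exact hall i)
  exact Finset.sum_pos' (fun j _ => mul_nonneg (he k j).le (hz k j))
    ⟨i, Finset.mem_univ i, mul_pos (he k i) ((hz k i).lt_of_ne' hi)⟩

theorem SPPMSeq.antitone_value {n m : ℕ} {F : Fin m → EuclideanSpace ℝ (Fin n) → ℝ}
    {x : ℕ → EuclideanSpace ℝ (Fin n)} {α : ℕ → ℝ} {e z : ℕ → EuclideanSpace ℝ (Fin m)}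
    (h : SPPMSeq F x α e z) (i : Fin m) : Antitone fun k => F i (x k) :=
  antitone_nat_of_succ_le fun k => (h.2.2.2.2 k).1 i

/-- The sequence is Fejér monotone with respect to the common lower level set. -/
theorem SPPMSeq.antitone_dist {n m : ℕ} {F : Fin m → EuclideanSpace ℝ (Fin n) → ℝ}
    {x : ℕ → EuclideanSpace ℝ (Fin n)} {α : ℕ → ℝ} {e z : ℕ → EuclideanSpace ℝ (Fin m)}
    (h : SPPMSeq F x α e z) (hsmooth : ∀ i, ContDiff ℝ 1 (F i))
    (hquasi : ∀ i, QuasiconvexFun (F i)) {y : EuclideanSpace ℝ (Fin n)}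
    (hy : ∀ k i, F i y ≤ F i (x k)) : Antitone fun k => dist (x k) y := by
  refine antitone_nat_of_succ_le fun k => ?_
  have hvar := h.variational_inequality hsmooth k (hy k)
  have hsum : ∑ i, z k i * fderiv ℝ (F i) (x (k + 1)) (y - x (k + 1)) ≤ 0 :=
    Finset.sum_nonpos fun i _ => mul_nonpos_of_nonneg_of_nonpos (h.2.2.1 k i)
      ((hquasi i).strictFDeriv_nonpos ((hsmooth i).contDiffAt.hasStrictFDerivAt one_ne_zero)
        (hy (k + 1) i))
  have hinner : 0 ≤ ⟪x (k + 1) - x k, y - x (k + 1)⟫ :=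
    nonneg_of_mul_nonneg_right (by linarith) (mul_pos (h.1 k) (h.sum_mul_pos k))
  have hsq := norm_add_sq_real (x (k + 1) - x k) (y - x (k + 1))
  rw [show x (k + 1) - x k + (y - x (k + 1)) = y - x k by abel] at hsq
  rw [dist_comm, dist_comm (x k), dist_eq_norm, dist_eq_norm]
  refine le_of_sq_le_sq ?_ (norm_nonneg _)
  nlinarith [sq_nonneg ‖x (k + 1) - x k‖]

theorem SPPMSeq.exists_tendsto {n m : ℕ} {F : Fin m → EuclideanSpace ℝ (Fin n) → ℝ}
    {x : ℕ → EuclideanSpace ℝ (Fin n)} {α : ℕ → ℝ} {e z : ℕ → EuclideanSpace ℝ (Fin m)}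
    (h : SPPMSeq F x α e z) (hsmooth : ∀ i, ContDiff ℝ 1 (F i))
    (hquasi : ∀ i, QuasiconvexFun (F i)) (hH3 : H3 F (x 0)) :
    ∃ a, Tendsto x atTop (𝓝 a) ∧ ∀ k i, F i a ≤ F i (x k) := by
  obtain ⟨b, hb⟩ := hH3 x rfl fun k => (h.2.2.2.2 k).1
  have hbdd : ∀ k, x k ∈ closedBall b (dist (x 0) b) := fun k =>
    h.antitone_dist hsmooth hquasi hb (Nat.zero_le k)
  obtain ⟨a, -, φ, hφ, ha⟩ := tendsto_subseq_of_bounded isBounded_closedBall hbdd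
  have hle : ∀ k i, F i a ≤ F i (x k) := fun k i => by
    refine le_of_tendsto (((hsmooth i).continuous.tendsto a).comp ha) ?_
    filter_upwards [hφ.tendsto_atTop.eventually_ge_atTop k] with j hj
    exact h.antitone_value i hj
  exact ⟨a, tendsto_of_antitone_dist_of_subseq (h.antitone_dist hsmooth hquasi hle)
    hφ.tendsto_atTop ha, hle⟩

theorem one_le_sum_of_norm_eq_one {m : ℕ} {z : EuclideanSpace ℝ (Fin m)} (hz : ∀ i, 0 ≤ z i)
    (hnorm : ‖z‖ = 1) : 1 ≤ ∑ i, z i := by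
  have hsq : ∑ i, z i ^ 2 = 1 := by
    have := EuclideanSpace.real_norm_sq_eq z
    rw [← this, hnorm, one_pow]
  have := Finset.sum_sq_le_sq_sum_of_nonneg (s := Finset.univ) (f := fun i => z i)
    fun i _ => hz i
  have := Finset.sum_nonneg fun i (_ : i ∈ Finset.univ) => hz i
  nlinarith

theorem sum_mul_le_one {m : ℕ} {e z : EuclideanSpace ℝ (Fin m)}
    (hne : ‖e‖ = 1) (hnz : ‖z‖ = 1) : ∑ i, e i * z i ≤ 1 := by
  have h := real_inner_le_norm z e
  rw [hne, hnz, PiLp.inner_apply] at h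
  simpa using h

theorem exists_pos_forall_lt_of_fderiv_neg {n : ℕ} {ι : Type*} [Finite ι]
    {F : ι → EuclideanSpace ℝ (Fin n) → ℝ} (hsmooth : ∀ i, ContDiff ℝ 1 (F i))
    {a d : EuclideanSpace ℝ (Fin n)} (hd : ∀ i, fderiv ℝ (F i) a d < 0) :
    ∃ t : ℝ, 0 < t ∧ ∀ i, F i (a + t • d) < F i a := by
  have hev : ∀ᶠ t : ℝ in 𝓝[>] 0, ∀ i, (F i (a + t • d) - F i a) / t < 0 :=
    eventually_all.2 fun i => (((hsmooth i).contDiffAt.hasStrictFDerivAt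
      one_ne_zero).tendsto_quotient d).eventually_lt_const (hd i)
  obtain ⟨t, ht, hpos⟩ := (hev.and self_mem_nhdsWithin).exists
  refine ⟨t, hpos, fun i => ?_⟩
  have := (div_lt_iff₀ hpos).1 (ht i)
  linarith

/-- When `F` is componentwise continuously differentiable and quasiconvex, the SPPM
sequence converges to a Pareto critical point `x̄`: for every direction `d` there is a
component `i₀` with `⟨∇F_{i₀}(x̄), d⟩ ≥ 0`. -/
theorem sppm_smooth_pareto_critical {n m : ℕ} (F : Fin m → EuclideanSpace ℝ (Fin n) → ℝ)
    (hsmooth : ∀ i, ContDiff ℝ 1 (F i))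
    (hquasi : ∀ i, QuasiconvexFun (F i))
    (hpos : ∀ x i, 0 < F i x)
    (x : ℕ → EuclideanSpace ℝ (Fin n)) (α : ℕ → ℝ) (e z : ℕ → EuclideanSpace ℝ (Fin m))
    (hsppm : SPPMSeq F x α e z)
    (hH3 : H3 F (x 0))
    (αbar : ℝ) (hαbar : 0 < αbar) (hα : ∀ k, 0 < α k ∧ α k < αbar)
    (hne : ∀ k, ‖e k‖ = 1) (hnz : ∀ k, ‖z k‖ = 1)
    (hint : ∀ k,
      (interior {y : EuclideanSpace ℝ (Fin n) | ∀ i, F i y ≤ F i (x (k + 1))}).Nonempty ∧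
      ∀ y ∈ interior {y : EuclideanSpace ℝ (Fin n) | ∀ i, F i y ≤ F i (x (k + 1))},
        ∀ i, F i y < F i (x (k + 1))) :
    ∃ xbar : EuclideanSpace ℝ (Fin n), Tendsto x atTop (𝓝 xbar) ∧
      ∀ d : EuclideanSpace ℝ (Fin n), ∃ i₀, 0 ≤ ⟪gradient (F i₀) xbar, d⟫ := by
  obtain ⟨a, ha, hle⟩ := hsppm.exists_tendsto hsmooth hquasi hH3
  refine ⟨a, ha, fun d => ?_⟩
  by_contra! hd
  have hd' : ∀ i, fderiv ℝ (F i) a d < 0 := fun i => by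
    simpa [gradient] using hd i
  obtain ⟨t, ht, hlt⟩ := exists_pos_forall_lt_of_fderiv_neg hsmooth hd'
  have ha1 : Tendsto (fun k => x (k + 1)) atTop (𝓝 a) := (tendsto_add_atTop_iff_nat 1).2 ha
  have hdir : Tendsto (fun k => a + t • d - x (k + 1)) atTop (𝓝 (t • d)) := by
    simpa using (tendsto_const_nhds (x := a + t • d)).sub ha1
  obtain ⟨c, hc, hcd⟩ : ∃ c : ℝ, 0 < c ∧ ∀ i, fderiv ℝ (F i) a (t • d) < -c := by
    have hev : ∀ᶠ c : ℝ in 𝓝[>] 0, ∀ i, fderiv ℝ (F i) a (t • d) < -c :=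
      eventually_all.2 fun i => by
        have hneg : fderiv ℝ (F i) a (t • d) < 0 := by
          rw [map_smul]
          exact mul_neg_of_pos_of_neg ht (hd' i)
        filter_upwards [Ioo_mem_nhdsGT (neg_pos.2 hneg)] with c hc
        linarith [hc.2]
    obtain ⟨c, hcd, hc⟩ := (hev.and self_mem_nhdsWithin).exists
    exact ⟨c, hc, hcd⟩
  have hderiv : ∀ᶠ k in atTop, ∀ i, fderiv ℝ (F i) (x (k + 1)) (a + t • d - x (k + 1)) < -c :=
    eventually_all.2 fun i => by
      have hcont : Continuous fun p => fderiv ℝ (F i) p (a + t • d - p) :=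
        ((hsmooth i).continuous_fderiv one_ne_zero).clm_apply (continuous_const.sub continuous_id)
      refine ((hcont.tendsto a).comp ha1).eventually_lt_const ?_
      rw [add_sub_cancel_left]
      exact hcd i
  have hprox : ∀ᶠ k in atTop,
      αbar * |⟪x (k + 1) - x k, a + t • d - x (k + 1)⟫| < c := by
    refine Tendsto.eventually_lt_const hc ?_
    simpa using ((ha1.sub ha).inner hdir).abs.const_mul αbar
  obtain ⟨k, hk, hk'⟩ := (hderiv.and hprox).exists
  have hvar := hsppm.variational_inequality hsmooth k fun i => (hlt i).le.trans (hle k i)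
  have hz := hsppm.2.2.1 k
  have hsum : ∑ i, z k i * fderiv ℝ (F i) (x (k + 1)) (a + t • d - x (k + 1)) ≤ -c :=
    calc
      _ ≤ ∑ i, z k i * -c :=
        Finset.sum_le_sum fun i _ => mul_le_mul_of_nonneg_left (hk i).le (hz i)
      _ = (∑ i, z k i) * -c := (Finset.sum_mul ..).symm
      _ ≤ -c := by nlinarith [one_le_sum_of_norm_eq_one hz (hnz k)]
  have hβ : α k * (∑ i, e k i * z k i) ≤ αbar :=
    (mul_le_of_le_one_right (hα k).1.le (sum_mul_le_one (hne k) (hnz k))).trans (hα k).2.le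
  have hβ0 : 0 ≤ α k * (∑ i, e k i * z k i) :=
    (mul_pos (hα k).1 (hsppm.sum_mul_pos k)).le
  have hbound : α k * (∑ i, e k i * z k i) * ⟪x (k + 1) - x k, a + t • d - x (k + 1)⟫ ≤
      αbar * |⟪x (k + 1) - x k, a + t • d - x (k + 1)⟫| :=
    (mul_le_mul_of_nonneg_left (le_abs_self _) hβ0).trans
      (mul_le_mul_of_nonneg_right hβ (abs_nonneg _))
  linarith
end

section
/- Let F = (F_1, …, F_m) : ℝⁿ → ℝᵐ have each component F_i locally Lipschitz on ℝⁿ and quasiconvex. Let x^k ∈ ℝⁿ, α_k > 0, e_k ∈ ℝᵐ with all components positive, z_k ∈ ℝᵐ with all components nonnegative and z_k ≠ 0, and set Ω_k = {x ∈ ℝⁿ : F(x) ⪯ F(x^k)} and h_k(x) = ⟨F(x), z_k⟩ + (α_k/2)⟨e_k, z_k⟩‖x − x^k‖². If x^{k+1} := x^k satisfies 0 ∈ ∂°h_k(x^{k+1}) + N_{Ω_k}(x^{k+1}), then x^k is a Pareto-Clarke critical point of F. -/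
open Filter Metric Set
open scoped Topology RealInnerProductSpace Pointwise

/-- The difference quotients defining the Clarke derivative of a locally Lipschitz function are
bounded near the base point. -/
lemma LocLipOn.eventually_abs_quotient_le {n : ℕ} {f : EuclideanSpace ℝ (Fin n) → ℝ}
    (hf : LocLipOn f) (x d : EuclideanSpace ℝ (Fin n)) :
    ∃ C : ℝ, ∀ᶠ p : EuclideanSpace ℝ (Fin n) × ℝ in 𝓝 x ×ˢ 𝓝[>] (0 : ℝ),
      |(f (p.1 + p.2 • d) - f p.1) / p.2| ≤ C := by
  obtain ⟨ε, hε, L, hL, h⟩ := hf x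
  refine ⟨L * ‖d‖, ?_⟩
  have hfst : Tendsto (fun p : EuclideanSpace ℝ (Fin n) × ℝ => p.1)
      (𝓝 x ×ˢ 𝓝[>] (0 : ℝ)) (𝓝 x) := tendsto_fst
  have hsnd : Tendsto (fun p : EuclideanSpace ℝ (Fin n) × ℝ => p.2)
      (𝓝 x ×ˢ 𝓝[>] (0 : ℝ)) (𝓝[>] 0) := tendsto_snd
  have hadd : Tendsto (fun p : EuclideanSpace ℝ (Fin n) × ℝ => p.1 + p.2 • d)
      (𝓝 x ×ˢ 𝓝[>] (0 : ℝ)) (𝓝 x) := by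
    simpa using hfst.add ((hsnd.mono_right nhdsWithin_le_nhds).smul_const d)
  filter_upwards [hfst (ball_mem_nhds x hε), hadd (ball_mem_nhds x hε),
    hsnd self_mem_nhdsWithin] with p h1 h2 h3
  have ht : 0 < p.2 := h3
  rw [abs_div, abs_of_pos ht, div_le_iff₀ ht]
  have := h _ h2 _ h1
  rw [add_sub_cancel_left, norm_smul, Real.norm_of_nonneg ht.le] at this
  linarith

/-- If the Clarke derivative of a locally Lipschitz function is below `c`, then so are all
nearby difference quotients. -/
lemma LocLipOn.eventually_quotient_lt {n : ℕ} {f : EuclideanSpace ℝ (Fin n) → ℝ}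
    (hf : LocLipOn f) {x d : EuclideanSpace ℝ (Fin n)} {c : ℝ} (hc : clarkeDeriv f x d < c) :
    ∀ᶠ p : EuclideanSpace ℝ (Fin n) × ℝ in 𝓝 x ×ˢ 𝓝[>] (0 : ℝ),
      (f (p.1 + p.2 • d) - f p.1) / p.2 < c := by
  obtain ⟨C, hC⟩ := hf.eventually_abs_quotient_le x d
  exact eventually_lt_of_limsup_lt hc
    (isBoundedUnder_of_eventually_le (hC.mono fun p hp => (abs_le.1 hp).2))

/-- A bound on the nearby difference quotients of a function bounds its Clarke derivative, as soon
as these quotients are bounded below. -/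
lemma clarkeDeriv_le_of_eventually_le {n : ℕ} {f : EuclideanSpace ℝ (Fin n) → ℝ}
    {x d : EuclideanSpace ℝ (Fin n)} {b c : ℝ}
    (hb : ∀ᶠ p : EuclideanSpace ℝ (Fin n) × ℝ in 𝓝 x ×ˢ 𝓝[>] (0 : ℝ),
      b ≤ (f (p.1 + p.2 • d) - f p.1) / p.2)
    (hc : ∀ᶠ p : EuclideanSpace ℝ (Fin n) × ℝ in 𝓝 x ×ˢ 𝓝[>] (0 : ℝ),
      (f (p.1 + p.2 • d) - f p.1) / p.2 ≤ c) :
    clarkeDeriv f x d ≤ c :=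
  limsup_le_of_le (isBoundedUnder_of_eventually_ge hb).isCoboundedUnder_le hc

/-- The difference quotients of `y ↦ ‖y - x‖ ^ 2` vanish in the limit at `x`. -/
lemma tendsto_quotient_norm_sub_sq {n : ℕ} (x d : EuclideanSpace ℝ (Fin n)) :
    Tendsto (fun p : EuclideanSpace ℝ (Fin n) × ℝ =>
      (‖p.1 + p.2 • d - x‖ ^ 2 - ‖p.1 - x‖ ^ 2) / p.2) (𝓝 x ×ˢ 𝓝[>] (0 : ℝ)) (𝓝 0) := by
  have hfst : Tendsto (fun p : EuclideanSpace ℝ (Fin n) × ℝ => p.1)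
      (𝓝 x ×ˢ 𝓝[>] (0 : ℝ)) (𝓝 x) := tendsto_fst
  have hsnd : Tendsto (fun p : EuclideanSpace ℝ (Fin n) × ℝ => p.2)
      (𝓝 x ×ˢ 𝓝[>] (0 : ℝ)) (𝓝[>] 0) := tendsto_snd
  have hlim : Tendsto (fun p : EuclideanSpace ℝ (Fin n) × ℝ =>
      2 * ⟪p.1 - x, d⟫ + p.2 * ‖d‖ ^ 2) (𝓝 x ×ˢ 𝓝[>] (0 : ℝ)) (𝓝 0) := by
    simpa using (((hfst.sub_const x).inner tendsto_const_nhds).const_mul 2).add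
      ((hsnd.mono_right nhdsWithin_le_nhds).mul_const (‖d‖ ^ 2))
  refine hlim.congr' ?_
  filter_upwards [hsnd self_mem_nhdsWithin] with p hp
  have ht : 0 < p.2 := hp
  rw [add_sub_right_comm, norm_add_sq_real, inner_smul_right, norm_smul,
    Real.norm_of_nonneg ht.le]
  field_simp
  ring

/-- If all components have negative Clarke derivative at `x` in the direction `d`, then so does
every nontrivial nonnegative combination of them plus a quadratic term centred at `x`. -/
lemma clarkeDeriv_prox_neg {n m : ℕ} {F : Fin m → EuclideanSpace ℝ (Fin n) → ℝ}
    (hlip : ∀ i, LocLipOn (F i)) {x d : EuclideanSpace ℝ (Fin n)} {z : EuclideanSpace ℝ (Fin m)}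
    (hz : ∀ i, 0 ≤ z i) (hz0 : z ≠ 0) (hd : ∀ i, clarkeDeriv (F i) x d < 0) (β : ℝ) :
    clarkeDeriv (fun y => (∑ i, z i * F i y) + β * ‖y - x‖ ^ 2) x d < 0 := by
  obtain ⟨j, hj⟩ : ∃ j, z j ≠ 0 := by
    by_contra! h
    exact hz0 (by ext i; simpa using h i)
  have hδ : ∑ i, z i * (clarkeDeriv (F i) x d / 2) < 0 :=
    Finset.sum_neg' (fun i _ => mul_nonpos_of_nonneg_of_nonpos (hz i) (by linarith [hd i]))
      ⟨j, Finset.mem_univ j,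
        mul_neg_of_pos_of_neg ((hz j).lt_of_ne' hj) (by linarith [hd j])⟩
  set δ := ∑ i, z i * (clarkeDeriv (F i) x d / 2)
  have hsplit : ∀ p : EuclideanSpace ℝ (Fin n) × ℝ,
      ((∑ i, z i * F i (p.1 + p.2 • d)) + β * ‖p.1 + p.2 • d - x‖ ^ 2 -
        ((∑ i, z i * F i p.1) + β * ‖p.1 - x‖ ^ 2)) / p.2 =
      (∑ i, z i * ((F i (p.1 + p.2 • d) - F i p.1) / p.2)) +
        β * ((‖p.1 + p.2 • d - x‖ ^ 2 - ‖p.1 - x‖ ^ 2) / p.2) := by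
    intro p
    simp only [mul_div_assoc', ← Finset.sum_div, mul_sub, Finset.sum_sub_distrib]
    ring
  have hquad : Tendsto (fun p : EuclideanSpace ℝ (Fin n) × ℝ =>
      β * ((‖p.1 + p.2 • d - x‖ ^ 2 - ‖p.1 - x‖ ^ 2) / p.2))
      (𝓝 x ×ˢ 𝓝[>] (0 : ℝ)) (𝓝 0) := by
    simpa using (tendsto_quotient_norm_sub_sq x d).const_mul β
  choose C hC using fun i => (hlip i).eventually_abs_quotient_le x d
  have hle : clarkeDeriv (fun y => (∑ i, z i * F i y) + β * ‖y - x‖ ^ 2) x d ≤ δ / 2 := by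
    refine clarkeDeriv_le_of_eventually_le (b := (∑ i, z i * -C i) + -1) ?_ ?_
    · filter_upwards [eventually_all.2 hC,
        hquad.eventually_const_lt (show (-1 : ℝ) < 0 by norm_num)] with p h1 h2
      rw [hsplit]
      exact add_le_add (Finset.sum_le_sum fun i _ =>
        mul_le_mul_of_nonneg_left (abs_le.1 (h1 i)).1 (hz i)) h2.le
    · filter_upwards [eventually_all.2 fun i => (hlip i).eventually_quotient_lt
          (show clarkeDeriv (F i) x d < clarkeDeriv (F i) x d / 2 by linarith [hd i]),
        hquad.eventually_lt_const (show (0 : ℝ) < -δ / 2 by linarith)] with p h1 h2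
      rw [hsplit]
      have h3 : ∑ i, z i * ((F i (p.1 + p.2 • d) - F i p.1) / p.2) ≤ δ :=
        Finset.sum_le_sum fun i _ => mul_le_mul_of_nonneg_left (h1 i).le (hz i)
      linarith
  linarith

/-- A direction in which all Clarke derivatives are negative has nonpositive inner product with every
normal to the sublevel set. -/
lemma inner_normalCone_nonpos {n m : ℕ} {F : Fin m → EuclideanSpace ℝ (Fin n) → ℝ}
    (hlip : ∀ i, LocLipOn (F i)) {x d v : EuclideanSpace ℝ (Fin n)}
    (hd : ∀ i, clarkeDeriv (F i) x d < 0)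
    (hv : v ∈ normalCone {y : EuclideanSpace ℝ (Fin n) | ∀ i, F i y ≤ F i x} x) :
    ⟪v, d⟫ ≤ 0 := by
  have hev : ∀ᶠ t in 𝓝[>] (0 : ℝ), ∀ i, (F i (x + t • d) - F i x) / t < 0 :=
    (eventually_all.2 fun i => (hlip i).eventually_quotient_lt (hd i)).curry.self_of_nhds
  obtain ⟨t, ht, ht0⟩ := (hev.and self_mem_nhdsWithin).exists
  have h := hv (x + t • d) fun i => by
    have := (div_lt_iff₀ ht0).1 (ht i)
    linarith
  rw [add_sub_cancel_left, inner_smul_right] at h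
  exact nonpos_of_mul_nonpos_right h ht0

/-- Stopping criterion: if `x^{k+1} = x^k` satisfies the SPPM inclusion, then `x^k` is a
Pareto-Clarke critical point of `F`. -/
theorem sppm_fixed_point_is_critical {n m : ℕ} (F : Fin m → EuclideanSpace ℝ (Fin n) → ℝ)
    (hlip : ∀ i, LocLipOn (F i)) (hquasi : ∀ i, QuasiconvexFun (F i))
    (xk : EuclideanSpace ℝ (Fin n)) (αk : ℝ) (hα : 0 < αk)
    (ek zk : EuclideanSpace ℝ (Fin m))
    (he : ∀ i, 0 < ek i) (hz : ∀ i, 0 ≤ zk i) (hz0 : zk ≠ 0)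
    (hfix : (0 : EuclideanSpace ℝ (Fin n)) ∈
      clarkeSubdiff
        (fun y => (∑ i, zk i * F i y) + αk / 2 * (∑ i, ek i * zk i) * ‖y - xk‖ ^ 2) xk +
      normalCone {y : EuclideanSpace ℝ (Fin n) | ∀ i, F i y ≤ F i xk} xk) :
    ∀ d : EuclideanSpace ℝ (Fin n), ∃ i, 0 ≤ clarkeDeriv (F i) xk d := by
  intro d
  by_contra! hd
  obtain ⟨w, hw, v, hv, hwv⟩ := Set.mem_add.1 hfix
  have hsum : ⟪w, d⟫ + ⟪v, d⟫ = 0 := by rw [← inner_add_left, hwv, inner_zero_left]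
  have hwd : ⟪w, d⟫ < 0 := (hw d).trans_lt (clarkeDeriv_prox_neg hlip hz hz0 hd _)
  linarith [inner_normalCone_nonpos hlip hd hv]
end
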